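/- Let G = (V, E) be a finite τ-critical simple graph with transversal number τ(G) = t. Then |V| ≤ 2t. -/

import Mathlib

open SimpleGraph

/-- A transversal set (vertex cover): a set of vertices meeting every edge. -/
def IsTransversal {V : Type*} (G : SimpleGraph V) (S : Set V) : Prop :=
  ∀ ⦃u v : V⦄, G.Adj u v → u ∈ S ∨ v ∈ S

/-- The transversal number: minimum cardinality of a transversal set. -/
noncomputable def tau {V : Type*} [Fintype V] (G : SimpleGraph V) : ℕ :=
  sInf {n | ∃ S : Finset V, IsTransversal G ↑S ∧ S.card = n}

/-- A graph with no isolated vertices is τ-critical if deleting any edge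
decreases the transversal number by one. -/
def TauCritical {V : Type*} [Fintype V] (G : SimpleGraph V) : Prop :=
  (∀ v : V, ∃ u, G.Adj v u) ∧
  ∀ e ∈ G.edgeSet, tau (G.deleteEdges {e}) = tau G - 1

lemma IsTransversal.tau_le {V : Type*} [Fintype V] {G : SimpleGraph V} {S : Finset V}
    (hS : IsTransversal G (S : Set V)) : tau G ≤ S.card :=
  Nat.sInf_le ⟨S, hS, rfl⟩

lemma exists_isTransversal_card_eq_tau {V : Type*} [Fintype V] (G : SimpleGraph V) :
    ∃ S : Finset V, IsTransversal G (S : Set V) ∧ S.card = tau G :=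
  Nat.sInf_mem (s := {n | ∃ S : Finset V, IsTransversal G (S : Set V) ∧ S.card = n})
    ⟨_, Finset.univ, fun _ _ _ => Or.inl (by simp), rfl⟩

lemma tau_pos_of_adj {V : Type*} [Fintype V] {G : SimpleGraph V} {a b : V} (hab : G.Adj a b) :
    0 < tau G := by
  obtain ⟨S, hS, hcard⟩ := exists_isTransversal_card_eq_tau G
  rw [← hcard, Finset.card_pos]
  rcases hS hab with h | h
  exacts [⟨a, h⟩, ⟨b, h⟩]

open Classical in
/-- The set of vertices adjacent to some vertex of `A`. -/
noncomputable def openNeighborhood {V : Type*} [Fintype V] (G : SimpleGraph V)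
    (A : Finset V) : Finset V :=
  Finset.univ.filter fun v => ∃ a ∈ A, G.Adj a v

@[simp]
lemma mem_openNeighborhood {V : Type*} [Fintype V] {G : SimpleGraph V} {A : Finset V} {v : V} :
    v ∈ openNeighborhood G A ↔ ∃ a ∈ A, G.Adj a v := by
  simp [openNeighborhood]

/-- Independent sets in a τ-critical graph satisfy Hall's condition. -/
theorem TauCritical.card_le_card_openNeighborhood {V : Type*} [Fintype V] {G : SimpleGraph V}
    (hcrit : TauCritical G) (A : Finset V) (hA : G.IsIndepSet (A : Set V)) :
    A.card ≤ (openNeighborhood G A).card := by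
  classical
  induction A using Finset.strongInduction with
  | H A ih =>
  by_contra! hlt
  obtain ⟨a, ha⟩ : A.Nonempty := Finset.card_pos.mp (by omega)
  obtain ⟨b, hab⟩ := hcrit.1 a
  obtain ⟨T, hT, hTcard⟩ := exists_isTransversal_card_eq_tau (G.deleteEdges {s(a, b)})
  rw [hcrit.2 s(a, b) hab] at hTcard
  have hpos := tau_pos_of_adj hab
  have hT_of_ne {u v : V} (huv : G.Adj u v) (hu : u ≠ a) (hv : v ≠ a) : u ∈ T ∨ v ∈ T := by
    simpa using hT (u := u) (v := v) (by
      simp only [deleteEdges_adj, Set.mem_singleton_iff, Sym2.eq_iff]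
      tauto)
  have hnotAdj {u v : V} (hu : u ∈ A) (hv : v ∈ A) : ¬ G.Adj u v := fun h =>
    hA hu hv h.ne h
  set N := openNeighborhood G A
  have hcover : IsTransversal G ((T \ A ∪ N : Finset V) : Set V) := by
    intro u v huv
    simp only [Finset.mem_coe, Finset.mem_union, Finset.mem_sdiff]
    by_cases hu : u ∈ A
    · exact Or.inr (Or.inr (mem_openNeighborhood.mpr ⟨u, hu, huv⟩))
    by_cases hv : v ∈ A
    · exact Or.inl (Or.inr (mem_openNeighborhood.mpr ⟨v, hv, huv.symm⟩))
    exact (hT_of_ne huv (fun h => hu (h ▸ ha)) (fun h => hv (h ▸ ha))).imp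
      (fun h => Or.inl ⟨h, hu⟩) (fun h => Or.inl ⟨h, hv⟩)
  have hunion_subset : T \ A ∪ N ⊆ T \ A ∪ N \ T := by
    refine Finset.union_subset Finset.subset_union_left fun v hvN => ?_
    obtain ⟨u, hu, huv⟩ := mem_openNeighborhood.mp hvN
    have hvA : v ∉ A := fun hvA => hnotAdj hu hvA huv
    simp [hvN, hvA, em]
  have hsub : A.erase a \ T ⊂ A :=
    Finset.sdiff_subset.trans_ssubset (Finset.erase_ssubset ha)
  have hHall := ih _ hsub (hA.mono (Finset.coe_subset.mpr hsub.subset))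
  have hnbr : openNeighborhood G (A.erase a \ T) ⊆ N ∩ T := by
    intro v hv
    obtain ⟨u, hu, huv⟩ := mem_openNeighborhood.mp hv
    simp only [Finset.mem_sdiff, Finset.mem_erase] at hu
    refine Finset.mem_inter.mpr ⟨mem_openNeighborhood.mpr ⟨u, hu.1.2, huv⟩, ?_⟩
    exact (hT_of_ne huv hu.1.1 (fun h => hnotAdj hu.1.2 (h ▸ ha) huv)).resolve_left hu.2
  have hnbr_card := Finset.card_le_card hnbr
  have htau := hcover.tau_le
  have hunion := (Finset.card_le_card hunion_subset).trans (Finset.card_union_le _ _)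
  have hsplitN := Finset.card_sdiff_add_card_inter N T
  have hsplitT := Finset.card_sdiff_add_card_inter T A
  have hsplitA := Finset.card_sdiff_add_card_inter (A.erase a) T
  have herase := Finset.card_erase_add_one ha
  have hinter : (A.erase a ∩ T).card ≤ (T ∩ A).card := by
    rw [Finset.inter_comm T A]
    exact Finset.card_le_card (Finset.inter_subset_inter_right (Finset.erase_subset a A))
  omega

theorem erdos_gallai_order_bound {V : Type*} [Fintype V]
    (G : SimpleGraph V) (t : ℕ) (hcrit : TauCritical G) (ht : tau G = t) :
    Fintype.card V ≤ 2 * t := by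
  classical
  obtain ⟨S, hS, hcard⟩ := exists_isTransversal_card_eq_tau G
  have hindep : G.IsIndepSet ((Sᶜ : Finset V) : Set V) := by
    intro u hu v hv _ huv
    have := hS huv
    simp_all
  have hHall := hcrit.card_le_card_openNeighborhood Sᶜ hindep
  have hsub : openNeighborhood G Sᶜ ⊆ S := by
    intro v hv
    obtain ⟨u, hu, huv⟩ := mem_openNeighborhood.mp hv
    exact (hS huv).resolve_left (by simpa using hu)
  have hle := Finset.card_le_card hsub
  have hcompl := Finset.card_add_card_compl S
  omega
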